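/- Let (W,S) be a finite Coxeter system with longest element w₀, and let c be a Coxeter element. For every c-singleton w with w ≠ w₀ there exists a simple reflection t ∈ S such that ℓ(wt) = ℓ(w) + 1 and wt is again a c-singleton. Consequently every c-singleton lies on an unrefinable chain of c-singletons leading up to w₀ in the right weak order. -/

import Mathlib

noncomputable section

namespace CambrianPaper

open CoxeterSystem

variable {B : Type*} {W : Type*} [Group W] {M : CoxeterMatrix B}

/-- One greedy pass of the letters of `c` over `u`: returns the taken letters (in order) and
the new remainder.  A letter `q` is taken if it is a left descent of the current remainder. -/
def pass (cs : CoxeterSystem M W) (c : List B) (u : W) : List B × W :=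
  c.foldl (fun p q =>
    if cs.length (cs.simple q * p.2) < cs.length p.2 then (p.1 ++ [q], cs.simple q * p.2)
    else p) ([], u)

/-- The remainder of `w` after `n` greedy passes of `c`. -/
def remainder (cs : CoxeterSystem M W) (c : List B) (w : W) : ℕ → W
  | 0 => w
  | n + 1 => (pass cs c (remainder cs c w n)).2

/-- The `n`-th factor (`n = 0, 1, 2, …`) of the `c`-factorization of `w`:
the letters of `c` taken in the `n`-th greedy pass.  (All but finitely many factors are
empty; the nonempty ones are the `c_{(K_i)}` of the `c`-factorization of `w`.) -/
def factor (cs : CoxeterSystem M W) (c : List B) (w : W) (n : ℕ) : List B :=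
  (pass cs c (remainder cs c w n)).1

/-- The `c`-sorting word of `w` : the concatenation of the factors of the
`c`-factorization of `w` (the lexicographically first reduced subword of `c^∞` for `w`);
`cs.length w` passes always suffice. -/
def sortingWord (cs : CoxeterSystem M W) (c : List B) (w : W) : List B :=
  ((List.range (cs.length w)).map (factor cs c w)).flatten

/-- `w` is `c`-sortable : the factors of its `c`-factorization are nested. -/
def IsSortable (cs : CoxeterSystem M W) (c : List B) (w : W) : Prop :=
  ∀ n : ℕ, ∀ q ∈ factor cs c w (n + 1), q ∈ factor cs c w n

/-- `w` is a `c`-singleton : `w` is `c`-sortable and `w w₀` is `c⁻¹`-sortable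
(the reduced word `c.reverse` represents the inverse of the Coxeter element). -/
def IsCSingleton (cs : CoxeterSystem M W) (c : List B) (w₀ w : W) : Prop :=
  IsSortable cs c w ∧ IsSortable cs c.reverse (w * w₀)

/-- The right weak order on `W`. -/
def weakLE (cs : CoxeterSystem M W) (u v : W) : Prop :=
  cs.length v = cs.length u + cs.length (u⁻¹ * v)

/-- A single commutation move on words: interchange two adjacent commuting letters. -/
def CommMove (M : CoxeterMatrix B) (l l' : List B) : Prop :=
  ∃ l₁ l₂ : List B, ∃ a b : B, M a b = 2 ∧ l = l₁ ++ a :: b :: l₂ ∧ l' = l₁ ++ b :: a :: l₂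

/-- Equivalence of words up to commutations. -/
def CommEquiv (M : CoxeterMatrix B) : List B → List B → Prop :=
  Relation.ReflTransGen (CommMove M)

/-- `u ∈ W` is a prefix of the word `v` up to commutations. -/
def IsPrefixUpToComm (cs : CoxeterSystem M W) (v : List B) (u : W) : Prop :=
  ∃ v' u' : List B, CommEquiv M v v' ∧ u' <+: v' ∧ cs.wordProd u' = u


section GeometricRepresentation

set_option linter.unusedSectionVars false

/-- Off-diagonal entries of the (negated, doubled) canonical bilinear form of a Coxeter matrix.
The convention `π / 0 = 0` yields the usual value for an infinite order. -/
def coef (M : CoxeterMatrix B) (a b : B) : ℝ := 2 * Real.cos (Real.pi / M a b)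

lemma coef_self (a : B) : coef M a a = -2 := by simp [coef]

lemma coef_comm (a b : B) : coef M a b = coef M b a := by
  simp [coef, M.symmetric a b]

lemma coef_nonneg {a b : B} (h : a ≠ b) : 0 ≤ coef M a b := by
  have h1 : M a b ≠ 1 := M.off_diagonal a b h
  refine mul_nonneg zero_le_two (Real.cos_nonneg_of_mem_Icc ⟨?_, ?_⟩)
  · have : 0 ≤ Real.pi / M a b := div_nonneg Real.pi_pos.le (Nat.cast_nonneg _)
    linarith [Real.pi_pos]
  · rcases Nat.eq_zero_or_pos (M a b) with h0 | h0
    · simp only [h0, Nat.cast_zero, div_zero]; positivity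
    · have h2 : (2 : ℝ) ≤ M a b := by exact_mod_cast (by omega : 2 ≤ M a b)
      exact div_le_div_of_nonneg_left Real.pi_pos.le two_pos h2

variable [Fintype B] [DecidableEq B]

/-- The simple root indexed by `a`. -/
def root (a : B) : B → ℝ := Pi.single a 1

lemma root_self (a : B) : root a a = 1 := by simp [root]

lemma root_of_ne {a b : B} (h : b ≠ a) : root a b = 0 := by simp [root, h]

/-- The pairing with the simple root `a`. -/
def pairing (M : CoxeterMatrix B) (a : B) : (B → ℝ) →ₗ[ℝ] ℝ :=
  ∑ b, coef M a b • LinearMap.proj b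

lemma pairing_apply (a : B) (v : B → ℝ) : pairing M a v = ∑ b, coef M a b * v b := by
  simp [pairing]

lemma pairing_root (a b : B) : pairing M a (root b) = coef M a b := by
  simp [pairing_apply, root, Pi.single_apply]

/-- The simple reflection of the geometric representation. -/
def reflection (M : CoxeterMatrix B) (a : B) : Module.End ℝ (B → ℝ) :=
  LinearMap.id + (pairing M a).smulRight (root a)

lemma reflection_apply (a : B) (v : B → ℝ) :
    reflection M a v = v + pairing M a v • root a := by
  simp [reflection]

lemma reflection_mul_self (a : B) : reflection M a * reflection M a = 1 := by
  refine LinearMap.ext fun v => ?_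
  simp only [Module.End.mul_apply, Module.End.one_apply, reflection_apply, map_add, map_smul,
    pairing_root, coef_self]
  module

lemma sin_smul_pow_root {a b : B} {θ : ℝ} (h : coef M a b = 2 * Real.cos θ) (n : ℕ) :
    Real.sin θ • ((reflection M a * reflection M b) ^ n) (root a) =
        Real.sin ((2 * n + 1) * θ) • root a + Real.sin (2 * n * θ) • root b ∧
      Real.sin θ • ((reflection M a * reflection M b) ^ n) (root b) =
        -Real.sin (2 * n * θ) • root a - Real.sin ((2 * n - 1) * θ) • root b := by
  have key : ∀ x : ℝ, Real.sin (x + θ) = 2 * Real.cos θ * Real.sin x - Real.sin (x - θ) := by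
    intro x; rw [Real.sin_add, Real.sin_sub]; ring
  induction n with
  | zero => simp
  | succ n ih =>
    have e1 := key ((2 * n + 1) * θ)
    have e2 := key ((2 * n + 2) * θ)
    have e3 := key (2 * n * θ)
    rw [show (2 * (n : ℝ) + 1) * θ + θ = 2 * (n + 1 : ℕ) * θ by push_cast; ring,
      show (2 * (n : ℝ) + 1) * θ - θ = 2 * n * θ by ring] at e1
    rw [show (2 * (n : ℝ) + 2) * θ + θ = (2 * (n + 1 : ℕ) + 1) * θ by push_cast; ring,
      show (2 * (n : ℝ) + 2) * θ - θ = (2 * n + 1) * θ by ring,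
      show (2 * (n : ℝ) + 2) * θ = 2 * (n + 1 : ℕ) * θ by push_cast; ring] at e2
    rw [show 2 * (n : ℝ) * θ + θ = (2 * n + 1) * θ by ring,
      show 2 * (n : ℝ) * θ - θ = (2 * n - 1) * θ by ring] at e3
    rw [show (2 * ((n + 1 : ℕ) : ℝ) - 1) * θ = (2 * n + 1) * θ by push_cast; ring]
    have hba : coef M b a = 2 * Real.cos θ := by rw [coef_comm, h]
    rw [pow_succ', Module.End.mul_apply, ← map_smul, ih.1, Module.End.mul_apply _ _ (root b),
      ← map_smul, ih.2]
    constructor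
    · simp only [Module.End.mul_apply, reflection_apply, map_add, map_smul, pairing_root,
        coef_self, hba, h, e2, e1]
      module
    · simp only [Module.End.mul_apply, reflection_apply, map_add, map_sub, map_smul,
        pairing_root, coef_self, hba, h, e1, e3]
      module

lemma isLiftable_reflection (M : CoxeterMatrix B) : M.IsLiftable (reflection M) := by
  intro a b
  by_cases hab : a = b
  · subst hab; simp [reflection_mul_self]
  rcases Nat.eq_zero_or_pos (M a b) with h0 | h0
  · simp [h0]
  set θ := Real.pi / M a b with hθ
  have hm : (M a b : ℝ) ≠ 0 := by positivity
  have h1 : M a b ≠ 1 := M.off_diagonal a b hab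
  have h2 : (2 : ℝ) ≤ M a b := by exact_mod_cast (by omega : 2 ≤ M a b)
  have hθm : 2 * (M a b : ℝ) * θ = 2 * Real.pi := by rw [hθ]; field_simp
  have hsin : 0 < Real.sin θ := by
    apply Real.sin_pos_of_pos_of_lt_pi (by positivity)
    rw [hθ, div_lt_iff₀ (by positivity)]
    nlinarith [Real.pi_pos]
  have hc : coef M a b = 2 * Real.cos θ := rfl
  have hc' : coef M b a = 2 * Real.cos θ := by rw [coef_comm, hc]
  obtain ⟨ha, hb⟩ := sin_smul_pow_root hc (M a b)
  rw [add_mul, hθm, one_mul, Real.sin_two_pi] at ha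
  rw [sub_mul, hθm, one_mul, Real.sin_two_pi] at hb
  rw [add_comm (2 * Real.pi), Real.sin_add_two_pi] at ha
  rw [show 2 * Real.pi - θ = -θ + 2 * Real.pi by ring, Real.sin_add_two_pi, Real.sin_neg] at hb
  set T := (reflection M a * reflection M b) ^ (M a b) with hT
  have ha' : T (root a) = root a := by
    apply smul_right_injective _ hsin.ne'
    simpa using ha
  have hb' : T (root b) = root b := by
    apply smul_right_injective _ hsin.ne'
    simpa using hb
  refine LinearMap.ext fun v => ?_
  set x := pairing M a v with hx
  set y := pairing M b v with hy
  have hD : 4 - coef M a b ^ 2 ≠ 0 := by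
    rw [hc]; nlinarith [Real.sin_sq_add_cos_sq θ, pow_pos hsin 2]
  set c := coef M a b with hcc
  set p := -(2 * x + c * y) / (4 - c ^ 2) with hp
  set q := -(2 * y + c * x) / (4 - c ^ 2) with hq
  set v' := v - p • root a - q • root b with hv'
  have hva : pairing M a v' = 0 := by
    simp only [hv', map_sub, map_smul, pairing_root, coef_self, smul_eq_mul, ← hx, ← hcc]
    rw [hp, hq]; field_simp; ring
  have hvb : pairing M b v' = 0 := by
    simp only [hv', map_sub, map_smul, pairing_root, coef_self, smul_eq_mul, ← hy, coef_comm b a,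
      ← hcc]
    rw [hp, hq]; field_simp; ring
  have hfix : T v' = v' := by
    have : ∀ n : ℕ, ((reflection M a * reflection M b) ^ n) v' = v' := by
      intro n
      induction n with
      | zero => simp
      | succ n ih =>
        rw [pow_succ', Module.End.mul_apply, ih, Module.End.mul_apply, reflection_apply b, hvb,
          zero_smul, add_zero, reflection_apply, hva, zero_smul, add_zero]
    exact this _
  have hv : v = v' + p • root a + q • root b := by rw [hv']; module
  rw [Module.End.one_apply]
  conv_lhs => rw [hv]
  rw [map_add, map_add, map_smul, map_smul, hfix, ha', hb', ← hv]

/-- The geometric representation. -/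
def rep (cs : CoxeterSystem M W) : W →* Module.End ℝ (B → ℝ) :=
  cs.lift ⟨reflection M, isLiftable_reflection M⟩

variable (cs : CoxeterSystem M W)

lemma rep_simple (a : B) : rep cs (cs.simple a) = reflection M a :=
  cs.lift_apply_simple (isLiftable_reflection M) a

lemma rep_simple_apply (a : B) (v : B → ℝ) :
    rep cs (cs.simple a) v = v + pairing M a v • root a := by
  rw [rep_simple, reflection_apply]

lemma rep_mul_apply (g h : W) (v : B → ℝ) : rep cs (g * h) v = rep cs g (rep cs h v) := by
  rw [map_mul, Module.End.mul_apply]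

lemma rep_one_apply (v : B → ℝ) : rep cs 1 v = v := by
  rw [map_one, Module.End.one_apply]

lemma rep_inv_apply_self (g : W) (v : B → ℝ) : rep cs g⁻¹ (rep cs g v) = v := by
  rw [← rep_mul_apply, inv_mul_cancel, rep_one_apply]

lemma rep_apply_inv_self (g : W) (v : B → ℝ) : rep cs g (rep cs g⁻¹ v) = v := by
  rw [← rep_mul_apply, mul_inv_cancel, rep_one_apply]

lemma rep_simple_apply_of_ne {a b : B} (h : b ≠ a) (v : B → ℝ) :
    rep cs (cs.simple a) v b = v b := by
  rw [rep_simple_apply]; simp [root_of_ne h]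

lemma rep_simple_root_self (a : B) : rep cs (cs.simple a) (root a) = -root a := by
  rw [rep_simple_apply, pairing_root, coef_self]; module

/-- The invariant bilinear form. -/
def bil (M : CoxeterMatrix B) (u v : B → ℝ) : ℝ := ∑ a, u a * pairing M a v

lemma bil_root_left (a : B) (v : B → ℝ) : bil M (root a) v = pairing M a v := by
  simp [bil, root, Pi.single_apply]

lemma bil_comm (u v : B → ℝ) : bil M u v = bil M v u := by
  simp only [bil, pairing_apply, Finset.mul_sum]
  rw [Finset.sum_comm]
  refine Finset.sum_congr rfl fun a _ => Finset.sum_congr rfl fun b _ => ?_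
  rw [coef_comm]; ring

lemma bil_add_smul_left (u u' v : B → ℝ) (r : ℝ) :
    bil M (u + r • u') v = bil M u v + r * bil M u' v := by
  simp only [bil, Pi.add_apply, Pi.smul_apply, smul_eq_mul, Finset.mul_sum, add_mul,
    Finset.sum_add_distrib, mul_assoc]

lemma bil_add_smul_right (u v v' : B → ℝ) (r : ℝ) :
    bil M u (v + r • v') = bil M u v + r * bil M u v' := by
  rw [bil_comm, bil_add_smul_left, bil_comm v, bil_comm v']

lemma bil_rep (g : W) (u v : B → ℝ) : bil M (rep cs g u) (rep cs g v) = bil M u v := by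
  induction g using cs.simple_induction_left with
  | one => simp only [rep_one_apply]
  | mul_simple_left g a ih =>
    rw [rep_mul_apply, rep_mul_apply, rep_simple_apply, rep_simple_apply, bil_add_smul_left,
      bil_add_smul_right, bil_add_smul_right, bil_root_left, bil_root_left, pairing_root,
      coef_self, bil_comm _ (root a), bil_root_left, ih]
    ring

lemma bil_root_root_self (g : W) (a : B) :
    bil M (rep cs g (root a)) (rep cs g (root a)) = -2 := by
  rw [bil_rep, bil_root_left, pairing_root, coef_self]

/-- All coordinates with respect to the simple roots are nonnegative. -/
def IsPos (v : B → ℝ) : Prop := ∀ b, 0 ≤ v b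

/-- All coordinates with respect to the simple roots are nonpositive. -/
def IsNeg (v : B → ℝ) : Prop := ∀ b, v b ≤ 0

/-- Coordinates of the roots of a dihedral group; for `c = 2 cos θ` this is `sin (n θ) / sin θ`. -/
def dihedralCoef (c : ℝ) : ℕ → ℝ
  | 0 => 0
  | 1 => 1
  | n + 2 => c * dihedralCoef c (n + 1) - dihedralCoef c n

lemma dihedralCoef_two (n : ℕ) : dihedralCoef 2 n = n := by
  induction n using Nat.twoStepInduction with
  | zero => simp [dihedralCoef]
  | one => simp [dihedralCoef]
  | more n h1 h2 => rw [dihedralCoef, h1, h2]; push_cast; ring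

lemma dihedralCoef_mul_sin (θ : ℝ) (n : ℕ) :
    dihedralCoef (2 * Real.cos θ) n * Real.sin θ = Real.sin (n * θ) := by
  induction n using Nat.twoStepInduction with
  | zero => simp [dihedralCoef]
  | one => simp [dihedralCoef]
  | more n h1 h2 =>
    rw [dihedralCoef, sub_mul, mul_assoc, h1, h2]
    push_cast
    rw [show ((n : ℝ) + 2) * θ = (n + 1) * θ + θ by ring,
      show (n : ℝ) * θ = (n + 1) * θ - θ by ring, Real.sin_add, Real.sin_sub]
    ring

lemma dihedralCoef_nonneg {a b : B} (hab : a ≠ b) {n : ℕ} (hn : M a b ≠ 0 → n ≤ M a b) :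
    0 ≤ dihedralCoef (coef M a b) n := by
  rcases Nat.eq_zero_or_pos (M a b) with h0 | h0
  · rw [show coef M a b = 2 by simp [coef, h0], dihedralCoef_two]
    exact Nat.cast_nonneg n
  have h1 : M a b ≠ 1 := M.off_diagonal a b hab
  have h2 : (2 : ℝ) ≤ M a b := by exact_mod_cast (by omega : 2 ≤ M a b)
  have hsin : 0 < Real.sin (Real.pi / M a b) := by
    apply Real.sin_pos_of_pos_of_lt_pi (by positivity)
    rw [div_lt_iff₀ (by positivity)]
    nlinarith [Real.pi_pos]
  refine nonneg_of_mul_nonneg_left ?_ hsin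
  rw [coef, dihedralCoef_mul_sin]
  apply Real.sin_nonneg_of_nonneg_of_le_pi (by positivity)
  have hn' : (n : ℝ) ≤ M a b := by exact_mod_cast hn h0.ne'
  rw [mul_div_assoc', div_le_iff₀ (by positivity)]
  nlinarith [Real.pi_pos]

lemma rep_alternatingWord_root (a b : B) (k : ℕ) :
    rep cs (cs.wordProd (alternatingWord a b k)) (root a) =
      if Even k then
        dihedralCoef (coef M a b) (k + 1) • root a + dihedralCoef (coef M a b) k • root b
      else dihedralCoef (coef M a b) k • root a + dihedralCoef (coef M a b) (k + 1) • root b := by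
  induction k with
  | zero => simp [alternatingWord, dihedralCoef]
  | succ k ih =>
    rw [alternatingWord_succ', wordProd_cons, rep_mul_apply, ih]
    by_cases hk : Even k
    · have hk' : ¬ Even (k + 1) := by simpa [Nat.even_add_one] using hk
      simp only [hk, hk', if_true, if_false, rep_simple_apply, map_add, map_smul, pairing_root,
        coef_self, coef_comm b a, dihedralCoef]
      module
    · have hk' : Even (k + 1) := by simpa [Nat.even_add_one] using hk
      simp only [hk, hk', if_true, if_false, rep_simple_apply, map_add, map_smul, pairing_root,
        coef_self, dihedralCoef]
      module

lemma exists_dihedral_factorization {w : W} {a r : B} (hr : cs.IsRightDescent w r) :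
    ∃ (v : W) (k : ℕ), 0 < k ∧ w = v * cs.wordProd (alternatingWord a r k) ∧
      cs.length w = cs.length v + k ∧ ¬ cs.IsRightDescent v a ∧ ¬ cs.IsRightDescent v r := by
  classical
  let P : ℕ → Prop := fun k => ∃ v : W, w = v * cs.wordProd (alternatingWord a r k) ∧
    cs.length w = cs.length v + k
  have hP1 : P 1 := by
    refine ⟨w * cs.simple r, ?_, ?_⟩
    · simp [alternatingWord]
    · exact (cs.isRightDescent_iff.mp hr).symm
  have hle : ∀ k, P k → k ≤ cs.length w := by rintro k ⟨v, -, h⟩; omega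
  set k := Nat.findGreatest P (cs.length w) with hk
  have hk1 : 1 ≤ k := Nat.le_findGreatest (hle 1 hP1) hP1
  obtain ⟨v, hv, hl⟩ : P k := Nat.findGreatest_spec (hle 1 hP1) hP1
  have hmax : ¬ P (k + 1) := fun h => by
    have := Nat.le_findGreatest (hle _ h) h
    omega
  have hnext : ¬ cs.IsRightDescent v (if Even k then r else a) := by
    intro h
    refine hmax ⟨v * cs.simple (if Even k then r else a), ?_, ?_⟩
    · rw [alternatingWord_succ', wordProd_cons, hv]; simp [mul_assoc]
    · have := cs.isRightDescent_iff.mp h; omega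
  have hprev : ¬ cs.IsRightDescent v (if Even k then a else r) := by
    intro h
    obtain ⟨j, hj⟩ : ∃ j, k = j + 1 := ⟨k - 1, by omega⟩
    have e : (if Even k then a else r) = if Even j then r else a := by
      rw [hj]; by_cases hje : Even j <;> simp [Nat.even_add_one, hje]
    rw [e] at h
    have h2 := cs.isRightDescent_iff.mp h
    have h3 : w = (v * cs.simple (if Even j then r else a)) *
        cs.wordProd (alternatingWord a r j) := by
      rw [hv, hj, alternatingWord_succ', wordProd_cons, mul_assoc]
    have h4 := cs.length_mul_le (v * cs.simple (if Even j then r else a))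
      (cs.wordProd (alternatingWord a r j))
    have h5 := cs.length_wordProd_le (alternatingWord a r j)
    rw [length_alternatingWord] at h5
    rw [← h3] at h4
    omega
  refine ⟨v, k, hk1, hv, hl, ?_⟩
  by_cases he : Even k
  · simp only [he, if_true] at hnext hprev; exact ⟨hprev, hnext⟩
  · simp only [he, if_false] at hnext hprev; exact ⟨hnext, hprev⟩

lemma isPos_of_not_isRightDescent {w : W} {a : B} (h : ¬ cs.IsRightDescent w a) :
    IsPos (rep cs w (root a)) := by
  induction hn : cs.length w using Nat.strong_induction_on generalizing w a with
  | _ n ih =>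
    by_cases hw : w = 1
    · subst hw
      intro b
      rw [rep_one_apply]
      by_cases hb : b = a
      · subst hb; simp [root]
      · simp [root_of_ne hb]
    obtain ⟨r, hr⟩ := cs.exists_rightDescent_of_ne_one hw
    have har : a ≠ r := by rintro rfl; exact h hr
    obtain ⟨v, k, hk, rfl, hl, hva, hvr⟩ := exists_dihedral_factorization cs (a := a) hr
    have pa := ih _ (by omega) hva rfl
    have pr := ih _ (by omega) hvr rfl
    have hkm : M a r ≠ 0 → k + 1 ≤ M a r := by
      intro h0
      by_contra! hlt
      apply cs.not_isReduced_alternatingWord r a (m := k + 1)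
      · rwa [M.symmetric]
      · rwa [M.symmetric]
      · rw [CoxeterSystem.IsReduced, length_alternatingWord]
        have h1 := cs.length_mul_le v (cs.wordProd (alternatingWord r a (k + 1)))
        have h2 := cs.length_wordProd_le (alternatingWord r a (k + 1))
        rw [length_alternatingWord] at h2
        have h3 := cs.not_isRightDescent_iff.mp h
        rw [mul_assoc, ← wordProd_concat, ← alternatingWord_succ] at h3
        omega
    have c1 := dihedralCoef_nonneg (M := M) har hkm
    have c0 := dihedralCoef_nonneg (M := M) har (n := k) (fun h0 => by have := hkm h0; omega)
    intro b
    rw [rep_mul_apply, rep_alternatingWord_root]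
    have := pa b
    have := pr b
    split_ifs <;> simp only [map_add, map_smul, Pi.add_apply, Pi.smul_apply, smul_eq_mul] <;>
      positivity

lemma isNeg_of_isRightDescent {w : W} {a : B} (h : cs.IsRightDescent w a) :
    IsNeg (rep cs w (root a)) := by
  have h1 := isPos_of_not_isRightDescent cs (cs.isRightDescent_iff_not_isRightDescent_mul.mp h)
  rw [rep_mul_apply, rep_simple_root_self, map_neg] at h1
  intro b
  simpa using h1 b

lemma isPos_of_not_isLeftDescent {w : W} {a : B} (h : ¬ cs.IsLeftDescent w a) :
    IsPos (rep cs w⁻¹ (root a)) :=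
  isPos_of_not_isRightDescent cs (by rwa [cs.isRightDescent_inv_iff])

lemma isNeg_of_isLeftDescent {w : W} {a : B} (h : cs.IsLeftDescent w a) :
    IsNeg (rep cs w⁻¹ (root a)) :=
  isNeg_of_isRightDescent cs (by rwa [cs.isRightDescent_inv_iff])

/-- `v` is a root of the geometric representation. -/
def IsRoot (v : B → ℝ) : Prop := ∃ (w : W) (a : B), v = rep cs w (root a)

lemma isRoot_root (a : B) : IsRoot cs (root a) := ⟨1, a, (rep_one_apply cs _).symm⟩

variable {cs}

lemma IsRoot.rep {v : B → ℝ} (h : IsRoot cs v) (g : W) : IsRoot cs (rep cs g v) := by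
  obtain ⟨w, a, rfl⟩ := h
  exact ⟨g * w, a, (rep_mul_apply cs _ _ _).symm⟩

lemma IsRoot.bil_self {v : B → ℝ} (h : IsRoot cs v) : bil M v v = -2 := by
  obtain ⟨w, a, rfl⟩ := h
  exact bil_root_root_self cs w a

lemma IsRoot.isPos_or_isNeg {v : B → ℝ} (h : IsRoot cs v) : IsPos v ∨ IsNeg v := by
  obtain ⟨w, a, rfl⟩ := h
  by_cases hd : cs.IsRightDescent w a
  · exact Or.inr (isNeg_of_isRightDescent cs hd)
  · exact Or.inl (isPos_of_not_isRightDescent cs hd)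

lemma IsRoot.not_isNeg {v : B → ℝ} (h : IsRoot cs v) (hp : IsPos v) : ¬ IsNeg v := by
  intro hn
  have h0 : v = 0 := funext fun b => le_antisymm (hn b) (hp b)
  have := h.bil_self
  rw [h0] at this
  simp [bil] at this

lemma IsRoot.isNeg_of_not_isPos {v : B → ℝ} (h : IsRoot cs v) (hp : ¬ IsPos v) : IsNeg v :=
  h.isPos_or_isNeg.resolve_left hp

lemma IsRoot.isPos_of_not_isNeg {v : B → ℝ} (h : IsRoot cs v) (hp : ¬ IsNeg v) : IsPos v :=
  h.isPos_or_isNeg.resolve_right hp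

lemma IsPos.neg {v : B → ℝ} (h : IsPos v) : IsNeg (-v) := fun b => by simpa using h b

lemma IsNeg.neg {v : B → ℝ} (h : IsNeg v) : IsPos (-v) := fun b => by simpa using h b

lemma isPos_root (a : B) : IsPos (root a) := by
  intro b; by_cases hb : b = a
  · subst hb; simp [root]
  · simp [root_of_ne hb]

lemma IsRoot.neg {v : B → ℝ} (h : IsRoot cs v) : IsRoot cs (-v) := by
  obtain ⟨w, a, rfl⟩ := h
  exact ⟨w * cs.simple a, a, by rw [rep_mul_apply, rep_simple_root_self, map_neg]⟩

variable (cs)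

lemma isLeftDescent_iff_isNeg {w : W} {a : B} :
    cs.IsLeftDescent w a ↔ IsNeg (rep cs w⁻¹ (root a)) := by
  refine ⟨isNeg_of_isLeftDescent cs, fun h => ?_⟩
  by_contra hd
  exact ((isRoot_root cs a).rep _).not_isNeg (isPos_of_not_isLeftDescent cs hd) h

lemma isRightDescent_iff_isNeg {w : W} {a : B} :
    cs.IsRightDescent w a ↔ IsNeg (rep cs w (root a)) := by
  rw [← cs.isLeftDescent_inv_iff, isLeftDescent_iff_isNeg, inv_inv]

variable {cs}

lemma IsRoot.eq_root_of_support {v : B → ℝ} {a : B} (h : IsRoot cs v) (hp : IsPos v)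
    (hs : ∀ b, b ≠ a → v b = 0) : v = root a := by
  have hv : v = v a • root a := by
    funext b
    by_cases hb : b = a
    · subst hb; simp [root]
    · simp [root_of_ne hb, hs b hb]
  have h1 := h.bil_self
  have h2 : bil M v v = v a * (v a * -2) := by
    conv_lhs => rw [hv]
    rw [← zero_add (v a • root a), bil_add_smul_left, bil_root_left]
    simp [bil, pairing_root, coef_self]
  have h3 : v a = 1 := by
    have := hp a
    nlinarith
  rw [hv, h3, one_smul]

lemma IsRoot.isPos_simple {v : B → ℝ} {a : B} (h : IsRoot cs v) (hp : IsPos v)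
    (hne : v ≠ root a) : IsPos (CambrianPaper.rep cs (cs.simple a) v) := by
  by_contra hn
  have hn' := (h.rep (cs.simple a)).isNeg_of_not_isPos hn
  refine hne (h.eq_root_of_support hp fun b hb => le_antisymm ?_ (hp b))
  simpa [rep_simple_apply_of_ne cs hb] using hn' b

lemma IsRoot.isNeg_simple {v : B → ℝ} {a : B} (h : IsRoot cs v) (hp : IsNeg v)
    (hne : v ≠ -root a) : IsNeg (CambrianPaper.rep cs (cs.simple a) v) := by
  have := h.neg.isPos_simple hp.neg (a := a) (fun e => hne (by rw [← e, neg_neg]))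
  rw [map_neg] at this
  simpa using this.neg

variable (cs)

lemma mul_simple_eq_of_rep_root {w : W} {a b : B} (h : rep cs w (root a) = root b) :
    w * cs.simple a = cs.simple b * w := by
  have hact : ∀ v, rep cs (w * cs.simple a) v = rep cs (cs.simple b * w) v := by
    intro v
    rw [rep_mul_apply, rep_mul_apply, rep_simple_apply, rep_simple_apply, map_add, map_smul, h,
      ← bil_root_left a, ← bil_root_left b, ← h, bil_rep]
  by_contra hne
  have hne' : (cs.simple b * w)⁻¹ * (w * cs.simple a) ≠ 1 := by
    intro e; exact hne (inv_mul_eq_one.mp e).symm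
  obtain ⟨r, hr⟩ := cs.exists_rightDescent_of_ne_one hne'
  rw [isRightDescent_iff_isNeg, rep_mul_apply, hact, rep_inv_apply_self] at hr
  exact (isRoot_root cs r).not_isNeg (isPos_root r) hr

lemma mul_simple_eq_of_rep_root_neg {w : W} {a b : B} (h : rep cs w (root a) = -root b) :
    w * cs.simple a = cs.simple b * w := by
  have h1 : rep cs (w * cs.simple a) (root a) = root b := by
    rw [rep_mul_apply, rep_simple_root_self, map_neg, h, neg_neg]
  have h2 := mul_simple_eq_of_rep_root cs h1
  rw [cs.simple_mul_simple_cancel_right] at h2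
  rw [h2, cs.simple_mul_simple_cancel_left, ← h2]

/-- The pairing with the simple root `s`, without its diagonal term. -/
def offPairing (M : CoxeterMatrix B) (s : B) (v : B → ℝ) : ℝ := pairing M s v + 2 * v s

lemma offPairing_eq_sum (s : B) (v : B → ℝ) :
    offPairing M s v = ∑ b ∈ Finset.univ.erase s, coef M s b * v b := by
  rw [offPairing, pairing_apply, ← Finset.add_sum_erase _ _ (Finset.mem_univ s), coef_self]
  ring

lemma offPairing_nonneg {s : B} {v : B → ℝ} (h : IsPos v) : 0 ≤ offPairing M s v := by
  rw [offPairing_eq_sum]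
  exact Finset.sum_nonneg fun b hb =>
    mul_nonneg (coef_nonneg (Finset.ne_of_mem_erase hb).symm) (h b)

lemma offPairing_nonpos {s : B} {v : B → ℝ} (h : IsNeg v) : offPairing M s v ≤ 0 := by
  rw [offPairing_eq_sum]
  exact Finset.sum_nonpos fun b hb =>
    mul_nonpos_of_nonneg_of_nonpos (coef_nonneg (Finset.ne_of_mem_erase hb).symm) (h b)

lemma offPairing_add_smul (s : B) (u v : B → ℝ) (r : ℝ) :
    offPairing M s (u + r • v) = offPairing M s u + r * offPairing M s v := by
  simp only [offPairing, map_add, map_smul, Pi.add_apply, Pi.smul_apply, smul_eq_mul]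
  ring

lemma offPairing_root_of_ne {s a : B} (h : s ≠ a) : offPairing M s (root a) = coef M s a := by
  rw [offPairing, pairing_root, root_of_ne h]; ring

lemma offPairing_root_self (s : B) : offPairing M s (root s) = 0 := by
  rw [offPairing, pairing_root, root_self, coef_self]; ring

lemma rep_simple_apply_self (s : B) (v : B → ℝ) :
    rep cs (cs.simple s) v s = offPairing M s v - v s := by
  rw [rep_simple_apply, offPairing]
  simp [root_self]; ring

lemma offPairing_rep_simple (s : B) (v : B → ℝ) :
    offPairing M s (rep cs (cs.simple s) v) = offPairing M s v := by
  rw [rep_simple_apply, offPairing_add_smul, offPairing_root_self, mul_zero, add_zero]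

/-- The skew-symmetric form attached to a word in the simple reflections. -/
def skewForm (M : CoxeterMatrix B) : List B → (B → ℝ) → (B → ℝ) → ℝ
  | [], _, _ => 0
  | s :: d, u, v => u s * (d.map fun b => coef M s b * v b).sum -
      v s * (d.map fun b => coef M s b * u b).sum + skewForm M d u v

lemma skewForm_concat (d : List B) (s : B) (u v : B → ℝ) :
    skewForm M (d ++ [s]) u v = skewForm M d u v -
      (u s * (d.map fun b => coef M s b * v b).sum -
        v s * (d.map fun b => coef M s b * u b).sum) := by
  induction d with
  | nil => simp [skewForm]
  | cons b d ih =>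
    simp only [List.cons_append, skewForm, ih, List.map_append, List.sum_append, List.map_cons,
      List.sum_cons, List.map_nil, List.sum_nil, coef_comm b s]
    ring

lemma skewForm_congr {d : List B} {u u' v v' : B → ℝ} (hu : ∀ b ∈ d, u b = u' b)
    (hv : ∀ b ∈ d, v b = v' b) : skewForm M d u v = skewForm M d u' v' := by
  induction d with
  | nil => rfl
  | cons s d ih =>
    have h1 : (d.map fun b => coef M s b * v b) = d.map fun b => coef M s b * v' b :=
      List.map_congr_left fun b hb => by rw [hv b (List.mem_cons_of_mem _ hb)]
    have h2 : (d.map fun b => coef M s b * u b) = d.map fun b => coef M s b * u' b :=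
      List.map_congr_left fun b hb => by rw [hu b (List.mem_cons_of_mem _ hb)]
    rw [skewForm, skewForm, h1, h2, hu s List.mem_cons_self, hv s List.mem_cons_self,
      ih (fun b hb => hu b (List.mem_cons_of_mem _ hb))
        (fun b hb => hv b (List.mem_cons_of_mem _ hb))]

lemma skewForm_zero (d : List B) (v : B → ℝ) :
    skewForm M d 0 v = 0 ∧ skewForm M d v 0 = 0 := by
  induction d with
  | nil => exact ⟨rfl, rfl⟩
  | cons s d ih => simp [skewForm, ih]

/-- A word containing every letter exactly once. -/
def IsComplete (d : List B) : Prop := d.Nodup ∧ ∀ b, b ∈ d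

lemma isComplete_concat_iff {s : B} {d : List B} :
    IsComplete (d ++ [s]) ↔ IsComplete (s :: d) := by
  have h : List.Perm (d ++ [s]) (s :: d) := List.perm_append_singleton s d
  rw [IsComplete, IsComplete, h.nodup_iff]
  simp only [h.mem_iff]

lemma IsComplete.reverse {d : List B} (h : IsComplete d) : IsComplete d.reverse :=
  ⟨List.nodup_reverse.mpr h.1, fun b => List.mem_reverse.mpr (h.2 b)⟩

lemma IsComplete.ne {s b : B} {d : List B} (h : IsComplete (s :: d)) (hb : b ∈ d) : b ≠ s := by
  rintro rfl
  exact (List.nodup_cons.mp h.1).1 hb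

lemma IsComplete.sum_eq {s : B} {d : List B} (h : IsComplete (s :: d)) (v : B → ℝ) :
    (d.map fun b => coef M s b * v b).sum = offPairing M s v := by
  have hd := List.nodup_cons.mp h.1
  rw [offPairing_eq_sum, ← List.sum_toFinset _ hd.2]
  refine Finset.sum_congr (Finset.ext fun b => ?_) fun _ _ => rfl
  have := h.2 b
  rw [List.mem_cons] at this
  simp only [List.mem_toFinset, Finset.mem_erase, Finset.mem_univ, and_true]
  exact ⟨h.ne, this.resolve_left⟩

lemma IsComplete.skewForm_cons {s : B} {d : List B} (h : IsComplete (s :: d)) (u v : B → ℝ) :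
    skewForm M (s :: d) u v =
      u s * offPairing M s v - v s * offPairing M s u + skewForm M d u v := by
  rw [skewForm, h.sum_eq, h.sum_eq]

lemma IsComplete.skewForm_concat {s : B} {d : List B} (h : IsComplete (s :: d)) (u v : B → ℝ) :
    skewForm M (d ++ [s]) u v =
      skewForm M d u v - (u s * offPairing M s v - v s * offPairing M s u) := by
  rw [CambrianPaper.skewForm_concat, h.sum_eq, h.sum_eq]

lemma IsComplete.skewForm_root_left {s : B} {d : List B} (h : IsComplete (s :: d))
    (v : B → ℝ) : skewForm M d (root s) v = 0 := by
  rw [← (skewForm_zero d v).1]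
  exact skewForm_congr (fun b hb => root_of_ne (h.ne hb)) fun _ _ => rfl

lemma IsComplete.skewForm_root_right {s : B} {d : List B} (h : IsComplete (s :: d))
    (v : B → ℝ) : skewForm M d v (root s) = 0 := by
  rw [← (skewForm_zero d v).2]
  exact skewForm_congr (fun _ _ => rfl) fun b hb => root_of_ne (h.ne hb)

lemma IsComplete.skewForm_rotate {s : B} {d : List B} (h : IsComplete (s :: d))
    (u v : B → ℝ) :
    skewForm M (d ++ [s]) (rep cs (cs.simple s) u) (rep cs (cs.simple s) v) =
      skewForm M (s :: d) u v := by
  rw [h.skewForm_concat, h.skewForm_cons, offPairing_rep_simple, offPairing_rep_simple,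
    rep_simple_apply_self, rep_simple_apply_self,
    skewForm_congr (fun b hb => rep_simple_apply_of_ne cs (h.ne hb) u)
      (fun b hb => rep_simple_apply_of_ne cs (h.ne hb) v)]
  ring

/-- `x` preserves the coordinate at `s`, i.e. lies in the parabolic subgroup omitting `s`. -/
def Avoids (s : B) (x : W) : Prop := ∀ v, rep cs x v s = v s

/-- `x` avoids `s` and all letters not commuting with `s`. -/
def Perp (s : B) (x : W) : Prop := ∀ b, coef M s b ≠ 0 → Avoids cs b x

variable {cs}

lemma avoids_one (s : B) : Avoids cs s 1 := fun v => by rw [rep_one_apply]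

lemma avoids_simple {s b : B} (h : s ≠ b) : Avoids cs s (cs.simple b) :=
  fun v => rep_simple_apply_of_ne cs h v

lemma Avoids.mul {s : B} {x y : W} (hx : Avoids cs s x) (hy : Avoids cs s y) :
    Avoids cs s (x * y) := fun v => by rw [rep_mul_apply, hx, hy]

lemma Avoids.inv {s : B} {x : W} (hx : Avoids cs s x) : Avoids cs s x⁻¹ := fun v => by
  rw [← hx (rep cs x⁻¹ v), rep_apply_inv_self]

lemma Avoids.not_isLeftDescent {s : B} {x : W} (hx : Avoids cs s x) :
    ¬ cs.IsLeftDescent x s := by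
  rw [isLeftDescent_iff_isNeg]
  intro h
  have := h s
  rw [hx.inv, root_self] at this
  linarith

lemma perp_one (s : B) : Perp cs s 1 := fun _ _ => avoids_one _

lemma perp_simple {s a : B} (h : coef M s a = 0) : Perp cs s (cs.simple a) :=
  fun b hb => avoids_simple (by rintro rfl; exact hb h)

lemma Perp.mul {s : B} {x y : W} (hx : Perp cs s x) (hy : Perp cs s y) :
    Perp cs s (x * y) := fun b hb => (hx b hb).mul (hy b hb)

lemma Perp.inv {s : B} {x : W} (hx : Perp cs s x) : Perp cs s x⁻¹ :=
  fun b hb => (hx b hb).inv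

lemma Perp.avoids {s : B} {x : W} (hx : Perp cs s x) : Avoids cs s x :=
  hx s (by rw [coef_self]; norm_num)

lemma Perp.pairing_rep {s : B} {x : W} (hx : Perp cs s x) (v : B → ℝ) :
    pairing M s (rep cs x v) = pairing M s v := by
  rw [pairing_apply, pairing_apply]
  refine Finset.sum_congr rfl fun b _ => ?_
  by_cases hb : coef M s b = 0
  · rw [hb, zero_mul, zero_mul]
  · rw [hx b hb]

lemma IsRoot.eq_root_of_pairing {s : B} {v : B → ℝ} (h : IsRoot cs v) (h1 : v s = 1)
    (h2 : pairing M s v = -2) : v = root s := by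
  have hp : IsPos v := h.isPos_of_not_isNeg fun hn => by linarith [hn s]
  have hn : IsNeg (CambrianPaper.rep cs (cs.simple s) v) :=
    (h.rep _).isNeg_of_not_isPos fun hp' => by
      have := hp' s
      rw [rep_simple_apply_self, offPairing, h1, h2] at this
      linarith
  refine h.eq_root_of_support hp fun b hb => le_antisymm ?_ (hp b)
  simpa [rep_simple_apply_of_ne cs hb] using hn b

lemma Perp.rep_root {s : B} {x : W} (hx : Perp cs s x) : rep cs x (root s) = root s :=
  ((isRoot_root cs s).rep x).eq_root_of_pairing (by rw [hx.avoids, root_self])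
    (by rw [hx.pairing_rep, pairing_root, coef_self])

lemma Perp.mul_simple {s : B} {x : W} (hx : Perp cs s x) :
    x * cs.simple s = cs.simple s * x := mul_simple_eq_of_rep_root cs hx.rep_root

lemma Avoids.apply_eq_zero {s : B} {x : W} (hx : Avoids cs s x) {v : B → ℝ} (hp : IsPos v)
    (hn : IsNeg (rep cs x⁻¹ v)) : v s = 0 :=
  le_antisymm (by rw [← hx.inv v]; exact hn s) (hp s)

lemma Perp.offPairing_eq_zero {s : B} {x : W} (hx : Perp cs s x) {v : B → ℝ} (hp : IsPos v)
    (hn : IsNeg (rep cs x⁻¹ v)) : offPairing M s v = 0 := by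
  rw [offPairing_eq_sum]
  refine Finset.sum_eq_zero fun b _ => ?_
  by_cases hb : coef M s b = 0
  · rw [hb, zero_mul]
  · rw [(hx b hb).apply_eq_zero hp hn, mul_zero]

lemma rep_simple_root_of_coef_eq_zero {a s : B} (h : coef M s a = 0) :
    rep cs (cs.simple a) (root s) = root s := by
  rw [rep_simple_apply, pairing_root, coef_comm, h, zero_smul, add_zero]

lemma perp_of_rep_root {s : B} {w : W} (ha : Avoids cs s w)
    (hr : rep cs w⁻¹ (root s) = root s) : Perp cs s w := by
  induction hn : cs.length w using Nat.strong_induction_on generalizing w with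
  | _ n ih =>
    by_cases hw : w = 1
    · subst hw; exact perp_one s
    obtain ⟨a, hd⟩ := cs.exists_leftDescent_of_ne_one hw
    have has : a ≠ s := by rintro rfl; exact ha.not_isLeftDescent hd
    have hneg := isNeg_of_isLeftDescent cs hd
    have hra := (isRoot_root cs a).rep w⁻¹
    have hk : coef M s a = 0 := by
      by_contra hk
      have hk' : 0 < coef M s a := lt_of_le_of_ne (coef_nonneg has.symm) (Ne.symm hk)
      have e : rep cs w⁻¹ (rep cs (cs.simple s) (root a)) =
          rep cs w⁻¹ (root a) + coef M s a • root s := by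
        rw [rep_simple_apply, pairing_root, map_add, map_smul, hr]
      have hs0 : rep cs w⁻¹ (root a) s = 0 := by rw [ha.inv, root_of_ne has.symm]
      have hpos : IsPos (rep cs w⁻¹ (root a) + coef M s a • root s) := by
        rw [← e]
        refine (((isRoot_root cs a).rep _).rep _).isPos_of_not_isNeg fun h => ?_
        have := h s
        rw [e] at this
        simp [hs0, root_self] at this
        linarith
      refine hra.not_isNeg (fun b => ?_) hneg
      by_cases hb : b = s
      · rw [hb, hs0]
      · simpa [root_of_ne hb] using hpos b
    have hp : Perp cs s (cs.simple a * w) := by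
      refine ih _ (by rw [← hn]; exact hd) ((avoids_simple has.symm).mul ha) ?_ rfl
      rw [mul_inv_rev, cs.inv_simple, rep_mul_apply, rep_simple_root_of_coef_eq_zero hk, hr]
    simpa using (perp_simple hk).mul hp

lemma perp_of_offPairing_nonpos {s : B} {x : W} (hs : ¬ cs.IsLeftDescent x s)
    (h : ∀ v, IsRoot cs v → IsPos v → IsNeg (rep cs x⁻¹ v) → offPairing M s v ≤ 0) :
    Perp cs s x := by
  induction hn : cs.length x using Nat.strong_induction_on generalizing x with
  | _ n ih =>
    by_cases hx : x = 1
    · subst hx; exact perp_one s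
    obtain ⟨a, hd⟩ := cs.exists_leftDescent_of_ne_one hx
    have hsa : s ≠ a := by rintro rfl; exact hs hd
    have hneg := isNeg_of_isLeftDescent cs hd
    have hk : coef M s a = 0 := by
      have := h _ (isRoot_root cs a) (isPos_root a) hneg
      rw [offPairing_root_of_ne hsa] at this
      exact le_antisymm this (coef_nonneg hsa)
    have hinv : ∀ v, rep cs (cs.simple a * x)⁻¹ v = rep cs x⁻¹ (rep cs (cs.simple a) v) := by
      intro v; rw [mul_inv_rev, cs.inv_simple, rep_mul_apply]
    have hp : Perp cs s (cs.simple a * x) := by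
      refine ih _ (by rw [← hn]; exact hd) ?_ (fun v hv hvp hvn => ?_) rfl
      · rwa [isLeftDescent_iff_isNeg, hinv, rep_simple_root_of_coef_eq_zero hk,
          ← isLeftDescent_iff_isNeg]
      · have hva : v ≠ root a := by
          rintro rfl
          rw [hinv, rep_simple_root_self, map_neg] at hvn
          exact ((isRoot_root cs a).rep x⁻¹).not_isNeg (by simpa using hvn.neg) hneg
        rw [hinv] at hvn
        have := h _ (hv.rep _) (hv.isPos_simple hvp hva) hvn
        rwa [rep_simple_apply, offPairing_add_smul, offPairing_root_of_ne hsa, hk, mul_zero,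
          add_zero] at this
    simpa using (perp_simple hk).mul hp

variable (cs)

/-- Remove the letter `s` from the left of `u` if it is a left descent. -/
def strip (s : B) (u : W) : W :=
  if cs.length (cs.simple s * u) < cs.length u then cs.simple s * u else u

lemma strip_of_isLeftDescent {s : B} {u : W} (h : cs.IsLeftDescent u s) :
    strip cs s u = cs.simple s * u := if_pos h

lemma strip_of_not_isLeftDescent {s : B} {u : W} (h : ¬ cs.IsLeftDescent u s) :
    strip cs s u = u := if_neg h

lemma length_strip_le (s : B) (u : W) : cs.length (strip cs s u) ≤ cs.length u := by
  by_cases h : cs.IsLeftDescent u s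
  · rw [strip_of_isLeftDescent cs h]; exact h.le
  · rw [strip_of_not_isLeftDescent cs h]

lemma pass_nil (u : W) : pass cs [] u = ([], u) := rfl

lemma pass_concat_snd (d : List B) (s : B) (u : W) :
    (pass cs (d ++ [s]) u).2 = strip cs s (pass cs d u).2 := by
  rw [pass, List.foldl_append, ← pass, strip]
  simp only [List.foldl_cons, List.foldl_nil]
  split_ifs <;> rfl

lemma mem_pass_concat (d : List B) (s q : B) (u : W) :
    q ∈ (pass cs (d ++ [s]) u).1 ↔
      q ∈ (pass cs d u).1 ∨ q = s ∧ cs.IsLeftDescent (pass cs d u).2 s := by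
  rw [pass, List.foldl_append, ← pass, IsLeftDescent]
  simp only [List.foldl_cons, List.foldl_nil]
  split_ifs with h <;> simp [h]

lemma foldl_pass (d l : List B) (u : W) :
    d.foldl (fun p q =>
      if cs.length (cs.simple q * p.2) < cs.length p.2 then (p.1 ++ [q], cs.simple q * p.2)
      else p) (l, u) = (l ++ (pass cs d u).1, (pass cs d u).2) := by
  induction d using List.reverseRecOn with
  | nil => simp [pass_nil]
  | append_singleton d s ih =>
    rw [pass, List.foldl_append, List.foldl_append, ih, ← pass]
    simp only [List.foldl_cons, List.foldl_nil]
    split_ifs <;> simp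

lemma pass_cons_snd (s : B) (d : List B) (u : W) :
    (pass cs (s :: d) u).2 = (pass cs d (strip cs s u)).2 := by
  rw [pass, List.foldl_cons, strip]
  split_ifs <;> rw [foldl_pass]

lemma mem_pass_cons (s q : B) (d : List B) (u : W) :
    q ∈ (pass cs (s :: d) u).1 ↔
      q = s ∧ cs.IsLeftDescent u s ∨ q ∈ (pass cs d (strip cs s u)).1 := by
  rw [pass, List.foldl_cons, strip, IsLeftDescent]
  split_ifs with h <;> rw [foldl_pass] <;> simp [h]

lemma mem_of_mem_pass {d : List B} {q : B} {u : W} (h : q ∈ (pass cs d u).1) : q ∈ d := by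
  induction d generalizing u with
  | nil => exact h
  | cons s d ih =>
    rw [mem_pass_cons] at h
    rcases h with h | h
    · exact h.1 ▸ List.mem_cons_self
    · exact List.mem_cons_of_mem _ (ih h)

lemma remainder_rotate (s : B) (d : List B) (x : W) (n : ℕ) :
    remainder cs (d ++ [s]) (strip cs s x) n = strip cs s (remainder cs (s :: d) x n) := by
  induction n with
  | zero => rfl
  | succ n ih => rw [remainder, ih, pass_concat_snd, remainder, pass_cons_snd]

lemma mem_factor_cons (s q : B) (d : List B) (x : W) (n : ℕ) :
    q ∈ factor cs (s :: d) x n ↔ q = s ∧ cs.IsLeftDescent (remainder cs (s :: d) x n) s ∨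
      q ∈ (pass cs d (strip cs s (remainder cs (s :: d) x n))).1 := mem_pass_cons ..

lemma mem_factor_rotate (s q : B) (d : List B) (x : W) (n : ℕ) :
    q ∈ factor cs (d ++ [s]) (strip cs s x) n ↔
      q ∈ (pass cs d (strip cs s (remainder cs (s :: d) x n))).1 ∨
      q = s ∧ cs.IsLeftDescent (remainder cs (s :: d) x (n + 1)) s := by
  rw [factor, remainder_rotate, mem_pass_concat, remainder, pass_cons_snd]

lemma isSortable_cons_iff {s : B} {d : List B} (hs : s ∉ d) (x : W) :
    IsSortable cs (s :: d) x ↔ IsSortable cs (d ++ [s]) (strip cs s x) ∧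
      (cs.IsLeftDescent (remainder cs (s :: d) x 1) s → cs.IsLeftDescent x s) := by
  have hmem : ∀ u, s ∉ (pass cs d u).1 := fun u h => hs (mem_of_mem_pass cs h)
  constructor
  · intro h
    have hR : ∀ n, cs.IsLeftDescent (remainder cs (s :: d) x (n + 1)) s →
        cs.IsLeftDescent (remainder cs (s :: d) x n) s := by
      intro n hn
      have := h n s ((mem_factor_cons ..).mpr (Or.inl ⟨rfl, hn⟩))
      exact (((mem_factor_cons ..).mp this).resolve_right (hmem _)).2
    refine ⟨fun n q hq => ?_, hR 0⟩
    rw [mem_factor_rotate] at hq ⊢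
    rcases hq with hq | ⟨rfl, hq⟩
    · have := h n q ((mem_factor_cons ..).mpr (Or.inr hq))
      rcases (mem_factor_cons ..).mp this with ⟨rfl, -⟩ | h'
      · exact absurd hq (hmem _)
      · exact Or.inl h'
    · exact Or.inr ⟨rfl, hR _ hq⟩
  · rintro ⟨h, h0⟩ n q hq
    rw [mem_factor_cons] at hq ⊢
    rcases hq with ⟨rfl, hq⟩ | hq
    · refine Or.inl ⟨rfl, ?_⟩
      cases n with
      | zero => exact h0 hq
      | succ n =>
        have := h n q ((mem_factor_rotate ..).mpr (Or.inr ⟨rfl, hq⟩))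
        exact (((mem_factor_rotate ..).mp this).resolve_left (hmem _)).2
    · have := h n q ((mem_factor_rotate ..).mpr (Or.inl hq))
      rcases (mem_factor_rotate ..).mp this with h' | ⟨rfl, -⟩
      · exact Or.inr h'
      · exact absurd hq (hmem _)

lemma length_pass_le (d : List B) (u : W) :
    cs.length (pass cs d u).2 ≤ cs.length u := by
  induction d generalizing u with
  | nil => rfl
  | cons s d ih => rw [pass_cons_snd]; exact (ih _).trans (length_strip_le cs s u)

lemma length_pass_lt {d : List B} {u : W} {b : B} (hb : b ∈ d) (hu : cs.IsLeftDescent u b) :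
    cs.length (pass cs d u).2 < cs.length u := by
  induction d with
  | nil => simp at hb
  | cons s d ih =>
    rw [pass_cons_snd]
    by_cases hs : cs.IsLeftDescent u s
    · rw [strip_of_isLeftDescent cs hs]
      exact (length_pass_le cs d _).trans_lt hs
    · rw [strip_of_not_isLeftDescent cs hs]
      rcases List.mem_cons.mp hb with rfl | hb
      · exact absurd hu hs
      · exact ih hb

lemma exists_remainder_eq_one {d : List B} (hd : ∀ b, b ∈ d) (x : W) :
    ∃ n, remainder cs d x n = 1 := by
  by_contra! h
  have hlt : ∀ n, cs.length (remainder cs d x n) + n ≤ cs.length x := by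
    intro n
    induction n with
    | zero => rfl
    | succ n ih =>
      obtain ⟨b, hb⟩ := cs.exists_leftDescent_of_ne_one (h n)
      have := length_pass_lt cs (hd b) hb
      rw [remainder]
      omega
  have := hlt (cs.length x + 1)
  omega

lemma avoids_mul_inv_pass {s : B} {d : List B} (hs : s ∉ d) (u : W) :
    Avoids cs s (u * (pass cs d u).2⁻¹) := by
  induction d generalizing u with
  | nil => rw [pass_nil, mul_inv_cancel]; exact avoids_one s
  | cons b d ih =>
    rw [List.mem_cons, not_or] at hs
    rw [pass_cons_snd]
    have h := ih hs.2 (strip cs b u)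
    by_cases hb : cs.IsLeftDescent u b
    · rw [strip_of_isLeftDescent cs hb] at h ⊢
      have := (avoids_simple (cs := cs) hs.1).mul h
      rwa [← mul_assoc, cs.simple_mul_simple_cancel_left] at this
    · rwa [strip_of_not_isLeftDescent cs hb] at h ⊢

lemma isSortable_cons_of_isLeftDescent {s : B} {d : List B} (hd : IsComplete (s :: d)) {x : W}
    (hx : cs.IsLeftDescent x s) :
    IsSortable cs (s :: d) x ↔ IsSortable cs (d ++ [s]) (cs.simple s * x) := by
  rw [isSortable_cons_iff cs (List.nodup_cons.mp hd.1).1, strip_of_isLeftDescent cs hx]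
  simp [hx]

lemma isSortable_cons_of_not_isLeftDescent {s : B} {d : List B} (hd : IsComplete (s :: d))
    {x : W} (hx : ¬ cs.IsLeftDescent x s) :
    IsSortable cs (s :: d) x ↔ Avoids cs s x ∧ IsSortable cs (d ++ [s]) x := by
  have hs := (List.nodup_cons.mp hd.1).1
  rw [isSortable_cons_iff cs hs, strip_of_not_isLeftDescent cs hx, and_comm]
  refine and_congr_left fun h => ⟨fun h1 => ?_, fun ha h1 => ?_⟩
  · have hsort : IsSortable cs (s :: d) x := by
      rw [isSortable_cons_iff cs hs, strip_of_not_isLeftDescent cs hx]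
      exact ⟨h, h1⟩
    have hR : ∀ n, ¬ cs.IsLeftDescent (remainder cs (s :: d) x n) s := by
      intro n
      induction n with
      | zero => exact hx
      | succ n ih =>
        intro hn
        have := hsort n s ((mem_factor_cons ..).mpr (Or.inl ⟨rfl, hn⟩))
        rcases (mem_factor_cons ..).mp this with h2 | h2
        · exact ih h2.2
        · exact hs (mem_of_mem_pass cs h2)
    have hav : ∀ n, Avoids cs s (x * (remainder cs (s :: d) x n)⁻¹) := by
      intro n
      induction n with
      | zero => rw [remainder, mul_inv_cancel]; exact avoids_one s
      | succ n ih =>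
        rw [remainder, pass_cons_snd, strip_of_not_isLeftDescent cs (hR n)]
        have := ih.mul (avoids_mul_inv_pass cs hs (remainder cs (s :: d) x n))
        rwa [mul_assoc, inv_mul_cancel_left] at this
    obtain ⟨n, hn⟩ := exists_remainder_eq_one cs hd.2 x
    simpa [hn] using hav n
  · refine absurd h1 (Avoids.not_isLeftDescent ?_)
    rw [remainder, remainder, pass_cons_snd, strip_of_not_isLeftDescent cs hx]
    simpa [mul_assoc] using (avoids_mul_inv_pass cs hs x).inv.mul ha

lemma pass_one (d : List B) : pass cs d 1 = ([], 1) := by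
  induction d using List.reverseRecOn with
  | nil => rfl
  | append_singleton d s ih =>
    rw [pass, List.foldl_append, ← pass, ih]
    simp

lemma isSortable_one (d : List B) : IsSortable cs d 1 := by
  have h : ∀ n, remainder cs d 1 n = 1 := by
    intro n
    induction n with
    | zero => rfl
    | succ n ih => rw [remainder, ih, pass_one]
  intro n q hq
  rw [factor, h, pass_one] at hq
  simp at hq

/-- Induction over pairs of a complete word and a group element, processing the first letter of
the word and moving it to the end. -/
lemma rotate_induction {P : List B → W → Prop}
    (one : ∀ d, IsComplete d → P d 1)
    (take : ∀ s d x, IsComplete (s :: d) → cs.IsLeftDescent x s →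
      P (d ++ [s]) (cs.simple s * x) → P (s :: d) x)
    (skip : ∀ s d x, IsComplete (s :: d) → ¬ cs.IsLeftDescent x s → P (d ++ [s]) x →
      P (s :: d) x)
    {d : List B} (hd : IsComplete d) (x : W) : P d x := by
  induction hn : cs.length x using Nat.strong_induction_on generalizing d x with
  | _ n ih =>
    by_cases hx : x = 1
    · subst hx; exact one d hd
    obtain ⟨b, hb⟩ := cs.exists_leftDescent_of_ne_one hx
    have htake : ∀ s d, IsComplete (s :: d) → cs.IsLeftDescent x s → P (s :: d) x :=
      fun s d hd hs => take s d x hd hs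
        (ih _ (by rw [← hn]; exact hs) (isComplete_concat_iff.mpr hd) _ rfl)
    obtain ⟨d₁, d₂, rfl⟩ := List.append_of_mem (hd.2 b)
    clear ih
    induction d₁ generalizing d₂ with
    | nil => exact htake b d₂ hd hb
    | cons s d₁ ih =>
      by_cases hs : cs.IsLeftDescent x s
      · exact htake s _ hd hs
      · have e : (d₁ ++ b :: d₂) ++ [s] = d₁ ++ b :: (d₂ ++ [s]) := by simp
        have hd' := isComplete_concat_iff.mpr hd
        refine skip s (d₁ ++ b :: d₂) x hd hs ?_
        rw [List.append_eq, e] at hd'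
        rw [e]
        exact ih _ hd'

lemma rep_inv_simple_mul (s : B) (x : W) (v : B → ℝ) :
    rep cs (cs.simple s * x)⁻¹ v = rep cs x⁻¹ (rep cs (cs.simple s) v) := by
  rw [mul_inv_rev, cs.inv_simple, rep_mul_apply]

lemma rep_inv_mul_simple (x : W) (q : B) (v : B → ℝ) :
    rep cs (x * cs.simple q)⁻¹ v = rep cs (cs.simple q) (rep cs x⁻¹ v) := by
  rw [mul_inv_rev, cs.inv_simple, rep_mul_apply]

lemma rep_simple_rep_simple (s : B) (v : B → ℝ) :
    rep cs (cs.simple s) (rep cs (cs.simple s) v) = v := by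
  rw [← rep_mul_apply, cs.simple_mul_simple_self, rep_one_apply]

lemma rep_injective (x : W) : Function.Injective (rep cs x) :=
  Function.LeftInverse.injective (rep_inv_apply_self cs x)

lemma ne_neg_root (v : B → ℝ) (hv : IsPos v) (q : B) : v ≠ -root q := by
  rintro rfl
  have := hv q
  simp [root_self] at this
  linarith

/-- Transport of an inversion of `s x` to an inversion of `x`. -/
lemma isPos_isNeg_of_simple_mul {s : B} {x : W} (hs : cs.IsLeftDescent x s) {v : B → ℝ}
    (hv : IsRoot cs v) (hp : IsPos v) (hn : IsNeg (rep cs (cs.simple s * x)⁻¹ v)) :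
    IsPos (rep cs (cs.simple s) v) ∧ IsNeg (rep cs x⁻¹ (rep cs (cs.simple s) v)) := by
  rw [rep_inv_simple_mul] at hn
  refine ⟨hv.isPos_simple hp ?_, hn⟩
  rintro rfl
  rw [rep_simple_root_self, map_neg] at hn
  exact ((isRoot_root cs s).rep x⁻¹).not_isNeg (by simpa using hn.neg)
    (isNeg_of_isLeftDescent cs hs)

/-- An inversion of a sortable element on which the skew form is extremal can be removed on the
right, keeping the element sortable. -/
lemma exists_isSortable_mul_simple {d : List B} (hd : IsComplete d) (x : W) :
    IsSortable cs d x → ∀ β, IsRoot cs β → IsPos β → IsNeg (rep cs x⁻¹ β) →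
      (∀ v, IsRoot cs v → IsPos v → IsNeg (rep cs x⁻¹ v) → skewForm M d β v ≤ 0) →
      ∃ q, rep cs x⁻¹ β = -root q ∧ IsSortable cs d (x * cs.simple q) := by
  refine rotate_induction cs (P := fun d x => IsSortable cs d x → ∀ β, IsRoot cs β → IsPos β →
    IsNeg (rep cs x⁻¹ β) →
      (∀ v, IsRoot cs v → IsPos v → IsNeg (rep cs x⁻¹ v) → skewForm M d β v ≤ 0) →
      ∃ q, rep cs x⁻¹ β = -root q ∧ IsSortable cs d (x * cs.simple q)) ?_ ?_ ?_ hd x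
  · intro d _ _ β hβ hp hn
    rw [inv_one, rep_one_apply] at hn
    exact absurd hn (hβ.not_isNeg hp)
  · intro s d x hd hs ih hx β hβ hp hn hω
    have hx' := (isSortable_cons_of_isLeftDescent cs hd hs).mp hx
    by_cases hβs : β = root s
    · subst hβs
      have hperp : Perp cs s (cs.simple s * x) := by
        refine perp_of_offPairing_nonpos (by simpa using
          (cs.isLeftDescent_iff_not_isLeftDescent_mul.mp hs)) fun v hv hvp hvn => ?_
        obtain ⟨h1, h2⟩ := isPos_isNeg_of_simple_mul cs hs hv hvp hvn
        have := hω _ (hv.rep _) h1 h2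
        rwa [hd.skewForm_cons, hd.skewForm_root_left, root_self, offPairing_root_self,
          offPairing_rep_simple, one_mul, mul_zero, sub_zero, add_zero] at this
      have e : x * cs.simple s = cs.simple s * x := by
        have := hperp.mul_simple
        rw [cs.simple_mul_simple_cancel_left] at this
        calc x * cs.simple s = cs.simple s * x * cs.simple s * cs.simple s := by rw [this]
          _ = cs.simple s * x := cs.simple_mul_simple_cancel_right s
      refine ⟨s, ?_, ?_⟩
      · have := hperp.inv.rep_root
        rw [rep_inv_simple_mul, rep_simple_root_self, map_neg] at this
        exact neg_eq_iff_eq_neg.mp this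
      · rw [e, isSortable_cons_of_not_isLeftDescent cs hd hperp.avoids.not_isLeftDescent]
        exact ⟨hperp.avoids, hx'⟩
    · have hinv : rep cs (cs.simple s * x)⁻¹ (rep cs (cs.simple s) β) = rep cs x⁻¹ β := by
        rw [rep_inv_simple_mul, rep_simple_rep_simple]
      obtain ⟨q, hq, hsort⟩ := ih hx' _ (hβ.rep (cs.simple s)) (hβ.isPos_simple hp hβs)
        (by rwa [hinv]) fun v hv hvp hvn => by
          obtain ⟨h1, h2⟩ := isPos_isNeg_of_simple_mul cs hs hv hvp hvn
          have := hω _ (hv.rep _) h1 h2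
          rwa [← hd.skewForm_rotate cs, rep_simple_rep_simple] at this
      rw [hinv] at hq
      refine ⟨q, hq, (isSortable_cons_of_isLeftDescent cs hd ?_).mpr (by rwa [← mul_assoc])⟩
      rw [isLeftDescent_iff_isNeg, rep_inv_mul_simple]
      refine ((isRoot_root cs s).rep _).isNeg_simple (isNeg_of_isLeftDescent cs hs) fun e => ?_
      exact hβs (rep_injective cs x⁻¹ (hq.trans e.symm))
  · intro s d x hd hs ih hx β hβ hp hn hω
    obtain ⟨hav, hx'⟩ := (isSortable_cons_of_not_isLeftDescent cs hd hs).mp hx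
    have hβs := hav.apply_eq_zero hp hn
    obtain ⟨q, hq, hsort⟩ := ih hx' β hβ hp hn fun v hv hvp hvn => by
      have := hω v hv hvp hvn
      rw [hd.skewForm_cons, hβs, hav.apply_eq_zero hvp hvn] at this
      rw [hd.skewForm_concat, hβs, hav.apply_eq_zero hvp hvn]
      linarith
    have hsq : s ≠ q := by
      rintro rfl
      have := hav.inv β
      rw [hq, hβs] at this
      simp [root_self] at this
    have hav' := hav.mul (avoids_simple (cs := cs) hsq)
    exact ⟨q, hq, (isSortable_cons_of_not_isLeftDescent cs hd hav'.not_isLeftDescent).mpr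
      ⟨hav', hsort⟩⟩

/-- A converse of `exists_isSortable_mul_simple`: adding an extremal root as an inversion. -/
lemma isSortable_of_isSortable_mul_simple {d : List B} (hd : IsComplete d) (x : W) :
    ∀ q, IsSortable cs d (x * cs.simple q) → IsPos (rep cs (x * cs.simple q) (root q)) →
      (∀ v, IsRoot cs v → IsPos (rep cs x⁻¹ v) →
        skewForm M d v (rep cs (x * cs.simple q) (root q)) ≤ 0) → IsSortable cs d x := by
  refine rotate_induction cs (P := fun d x => ∀ q, IsSortable cs d (x * cs.simple q) →
    IsPos (rep cs (x * cs.simple q) (root q)) → (∀ v, IsRoot cs v → IsPos (rep cs x⁻¹ v) →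
        skewForm M d v (rep cs (x * cs.simple q) (root q)) ≤ 0) → IsSortable cs d x) ?_ ?_ ?_ hd x
  · intro d _ q _ _ _
    exact isSortable_one cs d
  · intro r d x hd hr ih q hy hp hω
    rw [isSortable_cons_of_isLeftDescent cs hd hr]
    by_cases hry : cs.IsLeftDescent (x * cs.simple q) r
    · have e : ∀ v, rep cs (cs.simple r * x * cs.simple q) v =
          rep cs (cs.simple r) (rep cs (x * cs.simple q) v) := fun v => by
        rw [mul_assoc, rep_mul_apply]
      refine ih q ?_ ?_ fun v hv hvp => ?_
      · rw [mul_assoc]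
        exact (isSortable_cons_of_isLeftDescent cs hd hry).mp hy
      · rw [e]
        refine ((isRoot_root cs q).rep _).isPos_simple hp fun h => ?_
        have := isNeg_of_isLeftDescent cs hry
        rw [← h, rep_inv_apply_self] at this
        exact (isRoot_root cs q).not_isNeg (isPos_root q) this
      · rw [rep_inv_simple_mul] at hvp
        have := hω _ (hv.rep _) hvp
        rwa [← hd.skewForm_rotate cs, rep_simple_rep_simple, ← e] at this
    · have h1 : rep cs x⁻¹ (root r) = -root q := by
        by_contra hne
        refine hry ((isLeftDescent_iff_isNeg cs).mpr ?_)
        rw [rep_inv_mul_simple]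
        exact ((isRoot_root cs r).rep _).isNeg_simple (isNeg_of_isLeftDescent cs hr) hne
      have h2 : cs.simple r * x = x * cs.simple q := by
        have := congrArg (·⁻¹) (mul_simple_eq_of_rep_root_neg cs h1)
        simpa using this
      rw [h2]
      exact ((isSortable_cons_of_not_isLeftDescent cs hd hry).mp hy).2
  · intro r d x hd hr ih q hy hp hω
    set β := rep cs (x * cs.simple q) (root q) with hβ
    have hβ' : β = -rep cs x (root q) := by
      rw [hβ, rep_mul_apply, rep_simple_root_self, map_neg]
    have hβr : IsRoot cs β := (isRoot_root cs q).rep _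
    have hry : ¬ cs.IsLeftDescent (x * cs.simple q) r := by
      intro h
      have hne : rep cs x⁻¹ (root r) ≠ root q := by
        intro e
        have h0 : β = -root r := by rw [hβ', ← e, rep_apply_inv_self]
        exact ne_neg_root _ hp r h0
      have := isNeg_of_isLeftDescent cs h
      rw [rep_inv_mul_simple] at this
      exact (((isRoot_root cs r).rep _).rep _).not_isNeg
        (((isRoot_root cs r).rep _).isPos_simple (isPos_of_not_isLeftDescent cs hr) hne) this
    obtain ⟨hav, hy'⟩ := (isSortable_cons_of_not_isLeftDescent cs hd hry).mp hy
    have hoff : 0 ≤ offPairing M r β := offPairing_nonneg hp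
    have hrq : r ≠ q := by
      rintro rfl
      have hβ1 : β r = 1 := by rw [hβ, hav, root_self]
      have h1 := hω _ (isRoot_root cs r) (isPos_of_not_isLeftDescent cs hr)
      rw [hd.skewForm_cons, hd.skewForm_root_left, root_self, offPairing_root_self] at h1
      have h2 : β = root r := hβr.eq_root_of_pairing hβ1 (by
        rw [offPairing] at h1 hoff
        linarith)
      have h3 := isPos_of_not_isLeftDescent cs hr
      rw [← h2, hβ', map_neg, rep_inv_apply_self] at h3
      exact ne_neg_root _ h3 r rfl
    have havx : Avoids cs r x := by
      simpa using hav.mul (avoids_simple (cs := cs) hrq)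
    have hβ0 : β r = 0 := by rw [hβ, hav, root_of_ne hrq]
    refine (isSortable_cons_of_not_isLeftDescent cs hd hr).mpr ⟨havx, ih q hy' hp ?_⟩
    intro v hv hvp
    have h1 := hω v hv hvp
    have h2 : 0 ≤ v r * offPairing M r β :=
      mul_nonneg (by rw [← havx.inv v]; exact hvp r) hoff
    rw [hd.skewForm_cons, hβ0] at h1
    rw [← hβ, hd.skewForm_concat, hβ0]
    linarith

lemma simple_mul_eq_of_rep_inv_root {x : W} {s q : B} (h : rep cs x⁻¹ (root s) = -root q) :
    cs.simple s * x = x * cs.simple q := by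
  simpa using congrArg (·⁻¹) (mul_simple_eq_of_rep_root_neg cs h)

lemma rep_apply_eq_sum (g : W) (v : B → ℝ) :
    rep cs g v = ∑ b, v b • rep cs g (root b) := by
  conv_lhs => rw [← Finset.univ_sum_single v, map_sum]
  refine Finset.sum_congr rfl fun b _ => ?_
  rw [← map_smul]
  congr 1
  funext e
  simp [root, Pi.single_apply]

section LongestElement

variable {cs} {g w₀ : W}

lemma isNeg_rep_of_isPos (hg : ∀ b, IsNeg (rep cs g (root b))) {v : B → ℝ} (hv : IsPos v) :
    IsNeg (rep cs g v) := by
  intro e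
  rw [rep_apply_eq_sum, Finset.sum_apply]
  exact Finset.sum_nonpos fun b _ => mul_nonpos_of_nonneg_of_nonpos (hv b) (hg b e)

lemma IsRoot.isNeg_rep_iff (hg : ∀ b, IsNeg (CambrianPaper.rep cs g (root b))) {v : B → ℝ}
    (hv : IsRoot cs v) : IsNeg (CambrianPaper.rep cs g v) ↔ IsPos v := by
  refine ⟨fun h => ?_, isNeg_rep_of_isPos hg⟩
  by_contra hp
  have := isNeg_rep_of_isPos hg (hv.isNeg_of_not_isPos hp).neg
  rw [map_neg] at this
  exact (hv.rep g).not_isNeg (by simpa using this.neg) h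

lemma eq_root_of_rep_eq_neg_root (hg : ∀ b, IsNeg (rep cs g (root b))) {v : B → ℝ}
    (hv : IsPos v) {q b : B} (h : rep cs g v = -root q) (hb : 0 < v b) : v = root b := by
  have key : -rep cs g (root b) = root q := by
    refine ((isRoot_root cs b).rep g).neg.eq_root_of_support (hg b).neg fun e he => ?_
    have h0 : ∑ a, v a * rep cs g (root a) e = 0 := by
      have := congrFun h e
      rw [rep_apply_eq_sum, Finset.sum_apply] at this
      simpa [root_of_ne he] using this
    have := (Finset.sum_eq_zero_iff_of_nonpos fun a _ =>
      mul_nonpos_of_nonneg_of_nonpos (hv a) (hg a e)).mp h0 b (Finset.mem_univ b)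
    simpa [hb.ne'] using this
  exact rep_injective cs g (by rw [h, ← key, neg_neg])

lemma isNeg_rep_longest (hw₀ : ∀ u, cs.length u ≤ cs.length w₀) (b : B) :
    IsNeg (rep cs w₀ (root b)) := by
  refine isNeg_of_isRightDescent cs ?_
  by_contra h
  have := cs.not_isRightDescent_iff.mp h
  have := hw₀ (w₀ * cs.simple b)
  omega

lemma isNeg_rep_longest_inv (hw₀ : ∀ u, cs.length u ≤ cs.length w₀) (b : B) :
    IsNeg (rep cs w₀⁻¹ (root b)) :=
  isNeg_rep_longest (fun u => by rw [cs.length_inv]; exact hw₀ u) b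

lemma isLeftDescent_mul_longest_iff (hw₀ : ∀ u, cs.length u ≤ cs.length w₀) (u : W) (a : B) :
    cs.IsLeftDescent (u * w₀) a ↔ ¬ cs.IsLeftDescent u a := by
  have hr := (isRoot_root cs a).rep u⁻¹
  rw [isLeftDescent_iff_isNeg, mul_inv_rev, rep_mul_apply,
    hr.isNeg_rep_iff (isNeg_rep_longest_inv hw₀), isLeftDescent_iff_isNeg]
  exact ⟨hr.not_isNeg, hr.isPos_of_not_isNeg⟩

lemma longest_mul_self (hw₀ : ∀ u, cs.length u ≤ cs.length w₀) : w₀ * w₀ = 1 := by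
  by_contra h
  obtain ⟨a, ha⟩ := cs.exists_leftDescent_of_ne_one h
  exact (isLeftDescent_mul_longest_iff hw₀ w₀ a).mp ha
    ((isLeftDescent_iff_isNeg cs).mpr (isNeg_rep_longest_inv hw₀ a))

lemma exists_rep_longest_inv_root (hw₀ : ∀ u, cs.length u ≤ cs.length w₀) (s : B) :
    ∃ q, rep cs w₀⁻¹ (root s) = -root q := by
  have hn := isNeg_rep_longest_inv hw₀ s
  obtain ⟨b, hb⟩ : ∃ b, 0 < (-rep cs w₀⁻¹ (root s)) b := by
    by_contra! h
    exact ((isRoot_root cs s).rep w₀⁻¹).neg.not_isNeg hn.neg h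
  refine ⟨b, ?_⟩
  have := eq_root_of_rep_eq_neg_root (isNeg_rep_longest hw₀) hn.neg (q := s)
    (by rw [map_neg, rep_apply_inv_self]) hb
  rw [← this, neg_neg]

lemma IsComplete.reverse_cons {s : B} {d : List B} (h : IsComplete (s :: d)) :
    IsComplete (s :: d.reverse) := by
  have := h.reverse
  rwa [List.reverse_cons, isComplete_concat_iff] at this

lemma isCSingleton_cons_iff (hw₀ : ∀ u, cs.length u ≤ cs.length w₀) {s : B} {d : List B}
    (hd : IsComplete (s :: d)) {w : W} (hs : cs.IsLeftDescent w s) :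
    IsCSingleton cs (s :: d) w₀ w ↔ IsCSingleton cs (d ++ [s]) w₀ (cs.simple s * w) := by
  have h : cs.IsLeftDescent (cs.simple s * w * w₀) s :=
    (isLeftDescent_mul_longest_iff hw₀ _ s).mpr
      (cs.isLeftDescent_iff_not_isLeftDescent_mul.mp hs)
  rw [IsCSingleton, IsCSingleton, isSortable_cons_of_isLeftDescent cs hd hs,
    List.reverse_append, List.reverse_singleton, List.singleton_append, List.reverse_cons,
    isSortable_cons_of_isLeftDescent cs hd.reverse_cons h, mul_assoc,
    cs.simple_mul_simple_cancel_left]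

lemma perp_and_isCSingleton_rotate (hw₀ : ∀ u, cs.length u ≤ cs.length w₀) {s : B} {d : List B}
    (hd : IsComplete (s :: d)) {w : W} (hs : ¬ cs.IsLeftDescent w s)
    (h : IsCSingleton cs (s :: d) w₀ w) :
    Perp cs s w ∧ IsCSingleton cs (d ++ [s]) w₀ w := by
  obtain ⟨h1, h2⟩ := h
  rw [List.reverse_cons] at h2
  obtain ⟨hav, h1'⟩ := (isSortable_cons_of_not_isLeftDescent cs hd hs).mp h1
  have hsx := (isLeftDescent_mul_longest_iff hw₀ w s).mpr hs
  obtain ⟨q, hq, hsort⟩ := exists_isSortable_mul_simple cs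
    (isComplete_concat_iff.mpr hd.reverse_cons) (w * w₀) h2 (root s) (isRoot_root cs s)
    (isPos_root s) (isNeg_of_isLeftDescent cs hsx) fun v _ hv _ => by
      rw [hd.reverse_cons.skewForm_concat, hd.reverse_cons.skewForm_root_left, root_self,
        offPairing_root_self]
      linarith [offPairing_nonneg (M := M) (s := s) hv]
  rw [← simple_mul_eq_of_rep_inv_root cs hq] at hsort
  refine ⟨perp_of_rep_root hav ?_, h1', ?_⟩
  · rw [mul_inv_rev, rep_mul_apply] at hq
    refine eq_root_of_rep_eq_neg_root (isNeg_rep_longest_inv hw₀)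
      (isPos_of_not_isLeftDescent cs hs) hq ?_
    rw [hav.inv, root_self]
    exact one_pos
  · rw [List.reverse_append, List.reverse_singleton, List.singleton_append]
    exact (isSortable_cons_of_isLeftDescent cs hd.reverse_cons hsx).mpr hsort

lemma isCSingleton_cons_of_perp (hw₀ : ∀ u, cs.length u ≤ cs.length w₀) {s : B} {d : List B}
    (hd : IsComplete (s :: d)) {w : W} (hw : Perp cs s w)
    (h : IsCSingleton cs (d ++ [s]) w₀ w) : IsCSingleton cs (s :: d) w₀ w := by
  obtain ⟨h1, h2⟩ := h
  have hs := hw.avoids.not_isLeftDescent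
  refine ⟨(isSortable_cons_of_not_isLeftDescent cs hd hs).mpr ⟨hw.avoids, h1⟩, ?_⟩
  rw [List.reverse_append, List.reverse_singleton, List.singleton_append] at h2
  have hsx := (isLeftDescent_mul_longest_iff hw₀ w s).mpr hs
  have hsort := (isSortable_cons_of_isLeftDescent cs hd.reverse_cons hsx).mp h2
  obtain ⟨q, hq⟩ := exists_rep_longest_inv_root hw₀ s
  have hxq : rep cs (w * w₀)⁻¹ (root s) = -root q := by
    rw [mul_inv_rev, rep_mul_apply, hw.inv.rep_root, hq]
  have hβ : rep cs (w * w₀ * cs.simple q) (root q) = root s := by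
    rw [rep_mul_apply, rep_simple_root_self, ← hxq, rep_apply_inv_self]
  rw [simple_mul_eq_of_rep_inv_root cs hxq] at hsort
  rw [List.reverse_cons]
  refine isSortable_of_isSortable_mul_simple cs (isComplete_concat_iff.mpr hd.reverse_cons) _ q
    hsort (by rw [hβ]; exact isPos_root s) fun v hv hvp => ?_
  rw [hβ, hd.reverse_cons.skewForm_concat, hd.reverse_cons.skewForm_root_right, root_self,
    offPairing_root_self]
  suffices offPairing M s v ≤ 0 by linarith
  by_cases hvn : IsNeg v
  · exact offPairing_nonpos hvn
  refine (hw.offPairing_eq_zero (hv.isPos_of_not_isNeg hvn) ?_).le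
  by_contra hn
  have hv' := hv.rep w⁻¹
  rw [mul_inv_rev, rep_mul_apply] at hvp
  exact (hv'.rep _).not_isNeg hvp
    (isNeg_rep_of_isPos (isNeg_rep_longest_inv hw₀) (hv'.isPos_of_not_isNeg hn))

lemma IsCSingleton.one (hw₀ : ∀ u, cs.length u ≤ cs.length w₀) {c : List B}
    (hc : IsComplete c) {w : W} (h : IsCSingleton cs c w₀ w) : IsCSingleton cs c w₀ 1 := by
  refine rotate_induction cs (P := fun c w => IsCSingleton cs c w₀ w → IsCSingleton cs c w₀ 1)
    (fun _ _ h => h) (fun s d x hd hs ih h => ?_) (fun s d x hd hs ih h => ?_) hc w h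
  · exact isCSingleton_cons_of_perp hw₀ hd (perp_one s)
      (ih ((isCSingleton_cons_iff hw₀ hd hs).mp h))
  · exact isCSingleton_cons_of_perp hw₀ hd (perp_one s)
      (ih (perp_and_isCSingleton_rotate hw₀ hd hs h).2)

lemma IsCSingleton.longest (hw₀ : ∀ u, cs.length u ≤ cs.length w₀) {c : List B}
    (hc : IsComplete c) {w : W} (h : IsCSingleton cs c w₀ w) : IsCSingleton cs c w₀ w₀ := by
  have h' : IsCSingleton cs c.reverse w₀ (w * w₀) := by
    refine ⟨h.2, ?_⟩
    rw [List.reverse_reverse, mul_assoc, longest_mul_self hw₀, mul_one]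
    exact h.1
  have := (h'.one hw₀ hc.reverse).2
  rw [List.reverse_reverse, one_mul] at this
  refine ⟨this, ?_⟩
  rw [longest_mul_self hw₀]
  exact isSortable_one cs _

variable (cs) in
/-- Containment of inversion sets. -/
def InvLE (w z : W) : Prop :=
  ∀ v, IsRoot cs v → IsPos v → IsNeg (rep cs w⁻¹ v) → IsNeg (rep cs z⁻¹ v)

lemma InvLE.isLeftDescent {w z : W} (h : InvLE cs w z) {s : B} (hs : cs.IsLeftDescent w s) :
    cs.IsLeftDescent z s := by
  rw [isLeftDescent_iff_isNeg] at hs ⊢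
  exact h _ (isRoot_root cs s) (isPos_root s) hs

lemma InvLE.simple_mul {w z : W} (h : InvLE cs w z) {s : B} (hs : cs.IsLeftDescent w s) :
    InvLE cs (cs.simple s * w) (cs.simple s * z) := by
  intro v hv hp hn
  obtain ⟨h1, h2⟩ := isPos_isNeg_of_simple_mul cs hs hv hp hn
  rw [rep_inv_simple_mul]
  exact h _ (hv.rep _) h1 h2

/-- Any two comparable distinct `c`-singletons are separated by a covering of `c`-singletons
above the smaller one. -/
lemma exists_cover_isCSingleton (hw₀ : ∀ u, cs.length u ≤ cs.length w₀) {c : List B}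
    (hc : IsComplete c) (z : W) : ∀ w, IsCSingleton cs c w₀ w → IsCSingleton cs c w₀ z →
      InvLE cs w z → w ≠ z → ∃ t, cs.length (w * cs.simple t) = cs.length w + 1 ∧
        InvLE cs (w * cs.simple t) z ∧ IsCSingleton cs c w₀ (w * cs.simple t) := by
  refine rotate_induction cs (P := fun c z => ∀ w, IsCSingleton cs c w₀ w →
    IsCSingleton cs c w₀ z → InvLE cs w z → w ≠ z →
      ∃ t, cs.length (w * cs.simple t) = cs.length w + 1 ∧
        InvLE cs (w * cs.simple t) z ∧ IsCSingleton cs c w₀ (w * cs.simple t)) ?_ ?_ ?_ hc z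
  · intro d _ w _ _ hle hne
    obtain ⟨a, ha⟩ := cs.exists_leftDescent_of_ne_one hne
    exact absurd (hle.isLeftDescent ha) (avoids_one (cs := cs) a).not_isLeftDescent
  · intro s d z hd hsz ih w hw hz hle hne
    have hz' := (isCSingleton_cons_iff hw₀ hd hsz).mp hz
    have hszneg := isNeg_of_isLeftDescent cs hsz
    by_cases hsw : cs.IsLeftDescent w s
    · obtain ⟨t, ht, htle, htw⟩ := ih (cs.simple s * w)
        ((isCSingleton_cons_iff hw₀ hd hsw).mp hw) hz' (hle.simple_mul hsw) (by simpa using hne)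
      rw [mul_assoc] at ht htle htw
      have hst : cs.IsLeftDescent (w * cs.simple t) s := by
        rw [cs.isLeftDescent_iff_not_isLeftDescent_mul]
        exact fun h => cs.isLeftDescent_iff_not_isLeftDescent_mul.mp hsz (htle.isLeftDescent h)
      refine ⟨t, ?_, fun v hv hp hn => ?_, (isCSingleton_cons_iff hw₀ hd hst).mpr htw⟩
      · have := cs.isLeftDescent_iff.mp hsw
        have := cs.isLeftDescent_iff.mp hst
        omega
      · by_cases hvs : v = root s
        · rwa [hvs]
        have := htle _ (hv.rep (cs.simple s)) (hv.isPos_simple hp hvs)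
        rw [rep_inv_simple_mul, rep_inv_simple_mul, rep_simple_rep_simple] at this
        exact this hn
    · obtain ⟨hperp, hw'⟩ := perp_and_isCSingleton_rotate hw₀ hd hsw hw
      refine ⟨s, ?_, fun v hv hp hn => ?_, ?_⟩
      · rw [hperp.mul_simple]
        exact cs.not_isLeftDescent_iff.mp hsw
      · rw [rep_inv_mul_simple] at hn
        by_cases hvn : IsNeg (rep cs w⁻¹ v)
        · exact hle v hv hp hvn
        have hv' := hv.rep w⁻¹
        have e : rep cs w⁻¹ v = root s := by
          by_contra hne
          exact (hv'.rep _).not_isNeg (hv'.isPos_simple (hv'.isPos_of_not_isNeg hvn) hne) hn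
        have e' : v = root s := by rw [← hperp.rep_root, ← e, rep_apply_inv_self]
        rwa [e']
      · have hs : cs.IsLeftDescent (cs.simple s * w) s := by
          rw [cs.isLeftDescent_iff_not_isLeftDescent_mul, cs.simple_mul_simple_cancel_left]
          exact hsw
        rw [hperp.mul_simple, isCSingleton_cons_iff hw₀ hd hs, cs.simple_mul_simple_cancel_left]
        exact hw'
  · intro s d z hd hsz ih w hw hz hle hne
    have hsw : ¬ cs.IsLeftDescent w s := fun h => hsz (hle.isLeftDescent h)
    obtain ⟨hpw, hw'⟩ := perp_and_isCSingleton_rotate hw₀ hd hsw hw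
    obtain ⟨hpz, hz'⟩ := perp_and_isCSingleton_rotate hw₀ hd hsz hz
    obtain ⟨t, ht, htle, htw⟩ := ih w hw' hz' hle hne
    have hp : IsPos (rep cs w (root t)) :=
      isPos_of_not_isRightDescent cs (cs.not_isRightDescent_iff.mpr ht)
    have hn : IsNeg (rep cs z⁻¹ (rep cs w (root t))) := by
      refine htle _ ((isRoot_root cs t).rep w) hp ?_
      rw [rep_inv_mul_simple, rep_inv_apply_self, rep_simple_root_self]
      exact (isPos_root t).neg
    have hst : coef M s t = 0 := by
      by_contra hst
      have := (hpz t hst).apply_eq_zero hp hn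
      rw [hpw t hst, root_self] at this
      exact one_ne_zero this
    exact ⟨t, ht, htle, isCSingleton_cons_of_perp hw₀ hd (hpw.mul (perp_simple hst)) htw⟩

end LongestElement

end GeometricRepresentation

/-- Every `c`-singleton `w ≠ w₀` is covered (in right weak order) by another
`c`-singleton `w t`, `t ∈ S`; consequently every `c`-singleton lies on an unrefinable chain of
`c`-singletons leading up to `w₀`. -/
theorem statement3 [Finite W] (cs : CoxeterSystem M W)
    (c : List B) (hnd : c.Nodup) (hall : ∀ b : B, b ∈ c)
    (w₀ : W) (hw₀ : ∀ u : W, cs.length u ≤ cs.length w₀) :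
    (∀ w : W, IsCSingleton cs c w₀ w → w ≠ w₀ →
      ∃ t : B, cs.length (w * cs.simple t) = cs.length w + 1 ∧
        IsCSingleton cs c w₀ (w * cs.simple t)) ∧
    (∀ w : W, IsCSingleton cs c w₀ w →
      ∃ (k : ℕ) (f : ℕ → W), f 0 = w ∧ f k = w₀ ∧
        (∀ i ≤ k, IsCSingleton cs c w₀ (f i)) ∧
        (∀ i < k, ∃ t : B, f (i + 1) = f i * cs.simple t ∧
          cs.length (f (i + 1)) = cs.length (f i) + 1)) := by
  classical
  have : Fintype B := ⟨c.toFinset, fun b => List.mem_toFinset.mpr (hall b)⟩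
  have hc : IsComplete c := ⟨hnd, hall⟩
  have cover : ∀ w : W, IsCSingleton cs c w₀ w → w ≠ w₀ →
      ∃ t : B, cs.length (w * cs.simple t) = cs.length w + 1 ∧
        IsCSingleton cs c w₀ (w * cs.simple t) := by
    intro w hw hne
    obtain ⟨t, ht, -, htw⟩ := exists_cover_isCSingleton hw₀ hc w₀ w hw (hw.longest hw₀ hc)
      (fun v _ hp _ => isNeg_rep_of_isPos (isNeg_rep_longest_inv hw₀) hp) hne
    exact ⟨t, ht, htw⟩
  refine ⟨cover, fun w hw => ?_⟩
  induction hn : cs.length w₀ - cs.length w using Nat.strong_induction_on generalizing w with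
  | _ n ih =>
    by_cases hne : w = w₀
    · exact ⟨0, fun _ => w, rfl, hne, fun _ _ => hw, fun _ h => absurd h (Nat.not_lt_zero _)⟩
    obtain ⟨t, ht, htw⟩ := cover w hw hne
    have hle := hw₀ (w * cs.simple t)
    obtain ⟨k, f, hf0, hfk, hfs, hft⟩ := ih _ (by omega) (w * cs.simple t) htw rfl
    refine ⟨k + 1, fun | 0 => w | i + 1 => f i, rfl, hfk, fun i hi => ?_, fun i hi => ?_⟩
    · cases i with
      | zero => exact hw
      | succ i => exact hfs i (by omega)
    · cases i with
      | zero => exact ⟨t, hf0, by simpa only [hf0] using ht⟩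
      | succ i => exact hft i (by omega)

end CambrianPaper

end
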